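/- Let A = {a_1, …, a_{n+2}} ⊂ ℤ^n be a circuit of cardinality n+2, and let m = (m_1, …, m_{n+2}) ∈ ℤ^{n+2} be a vector with all coordinates nonzero, gcd of the |m_j| equal to 1, Σ_j m_j a_j = 0, and Σ_j m_j = 0, indexed so that m_j > 0 for 1 ≤ j ≤ k and m_j < 0 for k+1 ≤ j ≤ n+2. Let c_1, …, c_{n+2} be nonzero complex numbers and define f : (ℂ∖{0})^n → ℂ by f(x) = Σ_{j=1}^{n+2} c_j x^{a_j}. Then f has a degenerate root in (ℂ∖{0})^n — i.e., a point ζ ∈ (ℂ∖{0})^n with f(ζ) = 0 and ∂f/∂x_i(ζ) = 0 for all i ∈ {1,…,n} — if and only if (∏_{i=1}^{k} m_i^{m_i})(∏_{i=k+1}^{n+2} c_i^{−m_i}) = (∏_{i=k+1}^{n+2} m_i^{−m_i})(∏_{i=1}^{k} c_i^{m_i}). -/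

import Mathlib

open Finset

/-- A finite family of points of ℝ^n (indexed by Fin N) is a circuit: it is
affinely dependent, but every affine relation supported on a proper subset of
the indices is trivial. -/
def IsCircuitFam {N n : ℕ} (v : Fin N → (Fin n → ℝ)) : Prop :=
  (∃ γ : Fin N → ℝ, γ ≠ 0 ∧ ∑ j, γ j • v j = 0 ∧ ∑ j, γ j = 0) ∧
  (∀ S : Finset (Fin N), S ≠ Finset.univ →
    ∀ γ : Fin N → ℝ, (∀ j ∉ S, γ j = 0) →
      ∑ j, γ j • v j = 0 → ∑ j, γ j = 0 → γ = 0)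

/-- The real affine relations of a circuit form the line spanned by any nowhere zero relation. -/
lemma IsCircuitFam.eq_smul_real {N n : ℕ} {v : Fin N → (Fin n → ℝ)} (h : IsCircuitFam v)
    {μ : Fin N → ℝ} (hμv : ∑ j, μ j • v j = 0) (hμ : ∑ j, μ j = 0)
    (j₀ : Fin N) (hj₀ : μ j₀ ≠ 0) {γ : Fin N → ℝ} (hγv : ∑ j, γ j • v j = 0)
    (hγ : ∑ j, γ j = 0) (j : Fin N) : γ j = γ j₀ / μ j₀ * μ j := by
  have key := h.2 (univ.erase j₀) (by simp [Finset.erase_eq_self])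
    (fun j => γ j - γ j₀ / μ j₀ * μ j) (by
      intro j hj
      have hj' : j = j₀ := by simpa using hj
      subst hj'
      field_simp
      ring)
    (by simp only [sub_smul, sum_sub_distrib, mul_smul, ← smul_sum, hγv, hμv]; simp)
    (by simp only [sum_sub_distrib, ← mul_sum, hγ, hμ]; simp)
  exact sub_eq_zero.mp (congrFun key j)

/-- The complex affine relations of an integral circuit form the line spanned by any nowhere zero
integral relation. -/
lemma IsCircuitFam.exists_eq_mul_complex {N n : ℕ} {a : Fin N → Fin n → ℤ}
    (h : IsCircuitFam (fun j => fun i => (a j i : ℝ))) {m : Fin N → ℤ}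
    (hma : ∑ j, m j • a j = 0) (hm : ∑ j, m j = 0) (j₀ : Fin N) (hj₀ : m j₀ ≠ 0)
    {y : Fin N → ℂ} (hya : ∀ i, ∑ j, y j * (a j i : ℂ) = 0) (hy : ∑ j, y j = 0) :
    ∃ l : ℂ, ∀ j, y j = l * m j := by
  have hmv : ∑ j, (m j : ℝ) • (fun i => (a j i : ℝ)) = 0 := by
    funext i
    have := congrFun hma i
    simp only [Finset.sum_apply, Pi.smul_apply, smul_eq_mul, Pi.zero_apply] at this ⊢
    exact_mod_cast this
  have hmr : ∑ j, (m j : ℝ) = 0 := by exact_mod_cast hm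
  have hj : (m j₀ : ℝ) ≠ 0 := by exact_mod_cast hj₀
  have hre := h.eq_smul_real hmv hmr j₀ hj (γ := fun j => (y j).re)
    (by
      funext i
      have := congrArg Complex.re (hya i)
      simpa [Finset.sum_apply] using this)
    (by simpa using congrArg Complex.re hy)
  have him := h.eq_smul_real hmv hmr j₀ hj (γ := fun j => (y j).im)
    (by
      funext i
      have := congrArg Complex.im (hya i)
      simpa [Finset.sum_apply] using this)
    (by simpa using congrArg Complex.im hy)
  refine ⟨⟨(y j₀).re / m j₀, (y j₀).im / m j₀⟩, fun j => ?_⟩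
  apply Complex.ext
  · simpa using hre j
  · simpa using him j

/-- A complex vector orthogonal to the integral relation of a circuit is the restriction of an
affine function to the circuit. -/
lemma IsCircuitFam.exists_affine_eq {N n : ℕ} {a : Fin N → Fin n → ℤ}
    (h : IsCircuitFam (fun j => fun i => (a j i : ℝ))) {m : Fin N → ℤ}
    (hma : ∑ j, m j • a j = 0) (hm : ∑ j, m j = 0) (j₀ : Fin N) (hj₀ : m j₀ ≠ 0)
    {w : Fin N → ℂ} (hw : ∑ j, (m j : ℂ) * w j = 0) :
    ∃ (z : Fin n → ℂ) (s : ℂ), ∀ j, w j = ∑ i, (a j i : ℂ) * z i + s := by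
  let V : Submodule ℂ (Fin N → ℂ) :=
    Submodule.span ℂ (Set.range fun i j => (a j i : ℂ)) ⊔ Submodule.span ℂ {fun _ => 1}
  have hwV : w ∈ V := by
    by_contra hwV
    obtain ⟨f, hfw, hfV⟩ := Submodule.exists_le_ker_of_notMem hwV
    have hf : ∀ x : Fin N → ℂ, f x = ∑ j, f (Pi.single j 1) * x j := fun x => by
      rw [LinearMap.pi_apply_eq_sum_univ f x]
      refine sum_congr rfl fun j _ => ?_
      rw [smul_eq_mul, mul_comm]
      congr 2
      funext i
      simp [Pi.single_apply, eq_comm]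
    obtain ⟨l, hl⟩ := h.exists_eq_mul_complex hma hm j₀ hj₀ (y := fun j => f (Pi.single j 1))
      (fun i => by
        rw [← hf fun j => (a j i : ℂ)]
        exact hfV (Submodule.mem_sup_left (Submodule.subset_span ⟨i, rfl⟩)))
      (by
        have : f (fun _ => 1) = 0 :=
          hfV (Submodule.mem_sup_right (Submodule.subset_span rfl))
        simpa [hf fun _ => 1] using this)
    apply hfw
    rw [hf, ← mul_zero l, ← hw, mul_sum]
    exact sum_congr rfl fun j _ => by rw [hl j, mul_assoc]
  obtain ⟨x, hx, x', hx', rfl⟩ := Submodule.mem_sup.mp hwV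
  obtain ⟨z, rfl⟩ := (Submodule.mem_span_range_iff_exists_fun ℂ).mp hx
  obtain ⟨s, rfl⟩ := Submodule.mem_span_singleton.mp hx'
  exact ⟨z, s, fun j => by simp [Finset.sum_apply, mul_comm]⟩

/-- Integers without a common factor have an integral combination equal to one. -/
lemma exists_sum_mul_eq_one_of_gcd_natAbs {ι : Type*} [Fintype ι] (m : ι → ℤ)
    (h : univ.gcd (fun j => (m j).natAbs) = 1) : ∃ p : ι → ℤ, ∑ j, m j * p j = 1 := by
  have hspan : Ideal.span (Set.range m) = ⊤ := by
    obtain ⟨d, hd⟩ := IsPrincipalIdealRing.principal (Ideal.span (Set.range m))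
    have hdm : ∀ j, d ∣ m j := fun j => by
      have : m j ∈ Ideal.span (Set.range m) := Ideal.subset_span ⟨j, rfl⟩
      rw [hd] at this
      exact Ideal.mem_span_singleton.mp this
    have : d.natAbs ∣ 1 := h ▸ dvd_gcd fun j _ => Int.natAbs_dvd_natAbs.mpr (hdm j)
    rw [hd]
    exact Ideal.span_singleton_eq_top.mpr (Int.isUnit_iff_natAbs_eq.mpr (Nat.dvd_one.mp this))
  obtain ⟨p, hp⟩ := (Submodule.mem_span_range_iff_exists_fun ℤ).mp
    (show (1 : ℤ) ∈ Submodule.span ℤ (Set.range m) from (Ideal.eq_top_iff_one _).mp hspan)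
  exact ⟨p, by simpa [mul_comm] using hp⟩

/-- Nonzero numbers satisfying a primitive multiplicative relation have logarithms satisfying the
corresponding linear relation. -/
lemma exists_exp_eq_of_prod_zpow_eq_one {ι : Type*} [Fintype ι] {m : ι → ℤ}
    (hm : univ.gcd (fun j => (m j).natAbs) = 1) {u : ι → ℂ} (hu : ∀ j, u j ≠ 0)
    (h : ∏ j, u j ^ m j = 1) :
    ∃ w : ι → ℂ, (∀ j, Complex.exp (w j) = u j) ∧ ∑ j, (m j : ℂ) * w j = 0 := by
  obtain ⟨p, hp⟩ := exists_sum_mul_eq_one_of_gcd_natAbs m hm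
  have hlog : Complex.exp (∑ j, (m j : ℂ) * Complex.log (u j)) = 1 := by
    rw [Complex.exp_sum, ← h]
    exact prod_congr rfl fun j _ => by rw [Complex.exp_int_mul, Complex.exp_log (hu j)]
  obtain ⟨N, hN⟩ := Complex.exp_eq_one_iff.mp hlog
  refine ⟨fun j => Complex.log (u j) - (N * p j : ℤ) * (2 * Real.pi * Complex.I), fun j => ?_, ?_⟩
  · rw [Complex.exp_sub, Complex.exp_log (hu j), Complex.exp_int_mul_two_pi_mul_I, div_one]
  · have hp' : ∑ j, (m j : ℂ) * p j = 1 := by exact_mod_cast hp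
    have : ∑ j, (m j : ℂ) * ((N * p j : ℤ) * (2 * Real.pi * Complex.I)) =
        (∑ j, (m j : ℂ) * p j) * (N * (2 * Real.pi * Complex.I)) := by
      rw [sum_mul]
      exact sum_congr rfl fun j _ => by push_cast; ring
    simp only [mul_sub, sum_sub_distrib]
    rw [this, hp', hN, one_mul, sub_self]

/-- The partial derivative of a Laurent polynomial at a point of the torus. -/
lemma hasDerivAt_laurent_update {ι κ : Type*} [Fintype ι] [Fintype κ] [DecidableEq κ]
    (a : ι → κ → ℤ) (c : ι → ℂ) {ζ : κ → ℂ} (hζ : ∀ i, ζ i ≠ 0) (i : κ) :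
    HasDerivAt (fun t : ℂ => ∑ j, c j * ∏ i', (Function.update ζ i t i') ^ (a j i'))
      ((∑ j, (c j * ∏ i', ζ i' ^ a j i') * (a j i : ℂ)) / ζ i) (ζ i) := by
  have hfun : (fun t : ℂ => ∑ j, c j * ∏ i', (Function.update ζ i t i') ^ (a j i')) =
      fun t : ℂ => ∑ j, c j * (t ^ a j i * ∏ i' ∈ univ.erase i, ζ i' ^ a j i') := by
    funext t
    refine sum_congr rfl fun j _ => ?_
    rw [← mul_prod_erase univ _ (mem_univ i), Function.update_self]
    congr 2
    exact prod_congr rfl fun i' hi' => by rw [Function.update_of_ne (ne_of_mem_erase hi')]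
  rw [hfun, sum_div]
  refine HasDerivAt.fun_sum fun j _ => ?_
  refine (((hasDerivAt_zpow (a j i) (ζ i) (Or.inl (hζ i))).mul_const _).const_mul
    (c j)).congr_deriv ?_
  rw [← mul_prod_erase univ _ (mem_univ i), zpow_sub_one₀ (hζ i)]
  field_simp

/-- A partial derivative of a Laurent polynomial vanishes at a point of the torus if and only if
the corresponding exponents, weighted by the terms, sum to zero. -/
lemma hasDerivAt_laurent_update_zero_iff {ι κ : Type*} [Fintype ι] [Fintype κ] [DecidableEq κ]
    (a : ι → κ → ℤ) (c : ι → ℂ) {ζ : κ → ℂ} (hζ : ∀ i, ζ i ≠ 0) (i : κ) :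
    HasDerivAt (fun t : ℂ => ∑ j, c j * ∏ i', (Function.update ζ i t i') ^ (a j i')) 0 (ζ i) ↔
      ∑ j, (c j * ∏ i', ζ i' ^ a j i') * (a j i : ℂ) = 0 := by
  have h := hasDerivAt_laurent_update a c hζ i
  constructor
  · intro h0
    simpa [hζ i] using h.unique h0
  · intro h0
    simpa only [h0, zero_div] using h

/-- Splitting the index set, the binomial identity says that a single Laurent monomial is one. -/
lemma prod_filter_mul_eq_iff_prod_div_zpow {ι : Type*} [Fintype ι] (P Q : ι → Prop)
    [DecidablePred P] [DecidablePred Q] (hPQ : ∀ j, Q j ↔ ¬ P j) {x y : ι → ℂ}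
    (hx : ∀ j, x j ≠ 0) (hy : ∀ j, y j ≠ 0) (m : ι → ℤ) :
    (∏ j ∈ univ.filter P, x j ^ m j) * (∏ j ∈ univ.filter Q, y j ^ (-m j)) =
      (∏ j ∈ univ.filter Q, x j ^ (-m j)) * (∏ j ∈ univ.filter P, y j ^ m j) ↔
    ∏ j, (x j / y j) ^ m j = 1 := by
  have hQ : univ.filter Q = univ.filter fun j => ¬ P j := filter_congr fun j _ => hPQ j
  have h1 : ∏ j ∈ univ.filter Q, x j ^ m j ≠ 0 :=
    prod_ne_zero_iff.mpr fun j _ => zpow_ne_zero _ (hx j)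
  have h2 : ∏ j ∈ univ.filter Q, y j ^ m j ≠ 0 :=
    prod_ne_zero_iff.mpr fun j _ => zpow_ne_zero _ (hy j)
  have h3 : ∏ j ∈ univ.filter P, y j ^ m j ≠ 0 :=
    prod_ne_zero_iff.mpr fun j _ => zpow_ne_zero _ (hy j)
  rw [← prod_filter_mul_prod_filter_not univ P, ← hQ]
  simp only [div_zpow, prod_div_distrib, zpow_neg, prod_inv_distrib]
  field_simp

lemma prod_zpow_eq_zpow_sum {ι : Type*} (S : Finset ι) {x : ℂ} (hx : x ≠ 0) (e : ι → ℤ) :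
    ∏ j ∈ S, x ^ e j = x ^ ∑ j ∈ S, e j := by
  induction S using Finset.cons_induction with
  | empty => simp
  | cons j S hj ih => rw [prod_cons, sum_cons, zpow_add₀ hx, ih]

/-- For a circuit A ⊂ ℤ^n of cardinality n+2 with relation
vector m (positive entries first, up to index k), the Laurent polynomial
f = Σ c_j x^{a_j} has a degenerate root in (ℂ∖{0})^n iff the binomial
A-discriminant identity holds for the coefficients. -/
theorem circuit_discriminant_binomial_criterion
    (n k : ℕ) (hn : 1 ≤ n)
    (a : Fin (n + 2) → Fin n → ℤ) (hinj : Function.Injective a)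
    (hcirc : IsCircuitFam (fun j => fun i => (a j i : ℝ)))
    (m : Fin (n + 2) → ℤ)
    (hmgcd : Finset.univ.gcd (fun j => (m j).natAbs) = 1)
    (hma : ∑ j, m j • a j = 0)
    (hmsum : ∑ j, m j = 0)
    (hpos : ∀ j : Fin (n + 2), (j : ℕ) < k → 0 < m j)
    (hneg : ∀ j : Fin (n + 2), k ≤ (j : ℕ) → m j < 0)
    (c : Fin (n + 2) → ℂ) (hc : ∀ j, c j ≠ 0) :
    (∃ ζ : Fin n → ℂ, (∀ i, ζ i ≠ 0) ∧
        (∑ j, c j * ∏ i, (ζ i) ^ (a j i) = 0) ∧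
        (∀ i : Fin n,
          HasDerivAt
            (fun t : ℂ => ∑ j, c j * ∏ i', (Function.update ζ i t i') ^ (a j i'))
            0 (ζ i)))
      ↔
    (∏ j ∈ Finset.univ.filter (fun j : Fin (n + 2) => (j : ℕ) < k),
        ((m j : ℂ) ^ (m j))) *
      (∏ j ∈ Finset.univ.filter (fun j : Fin (n + 2) => k ≤ (j : ℕ)),
        ((c j) ^ (-(m j)))) =
    (∏ j ∈ Finset.univ.filter (fun j : Fin (n + 2) => k ≤ (j : ℕ)),
        ((m j : ℂ) ^ (-(m j)))) *
      (∏ j ∈ Finset.univ.filter (fun j : Fin (n + 2) => (j : ℕ) < k),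
        ((c j) ^ (m j))) := by
  have hm0 : ∀ j, m j ≠ 0 := fun j =>
    (lt_or_ge (j : ℕ) k).elim (fun h => (hpos j h).ne') fun h => (hneg j h).ne
  have hmC : ∀ j, (m j : ℂ) ≠ 0 := fun j => Int.cast_ne_zero.mpr (hm0 j)
  rw [prod_filter_mul_eq_iff_prod_div_zpow _ _ (fun j => not_lt.symm) hmC hc]
  constructor
  · rintro ⟨ζ, hζ, hroot, hder⟩
    obtain ⟨l, hl⟩ := hcirc.exists_eq_mul_complex hma hmsum 0 (hm0 0)
      (fun i => (hasDerivAt_laurent_update_zero_iff a c hζ i).mp (hder i)) hroot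
    have hmon : ∀ j, ∏ i, ζ i ^ a j i ≠ 0 := fun j =>
      prod_ne_zero_iff.mpr fun i _ => zpow_ne_zero _ (hζ i)
    have hl0 : l ≠ 0 := by
      rintro rfl
      exact mul_ne_zero (hc 0) (hmon 0) (by simpa using hl 0)
    have hdiv : ∀ j, (m j : ℂ) / c j = (∏ i, ζ i ^ a j i) / l := fun j => by
      rw [div_eq_div_iff (hc j) hl0, mul_comm _ l, ← hl j, mul_comm]
    simp only [hdiv, div_zpow, prod_div_distrib, ← prod_zpow, ← zpow_mul]
    rw [prod_comm, prod_zpow_eq_zpow_sum _ hl0, hmsum, zpow_zero, div_one]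
    refine prod_eq_one fun i _ => ?_
    rw [prod_zpow_eq_zpow_sum _ (hζ i)]
    have := congrFun hma i
    simp only [Finset.sum_apply, Pi.smul_apply, smul_eq_mul, Pi.zero_apply] at this
    simp only [mul_comm (a _ i), this, zpow_zero]
  · intro h
    obtain ⟨w, hwu, hw⟩ := exists_exp_eq_of_prod_zpow_eq_one hmgcd
      (fun j => div_ne_zero (hmC j) (hc j)) h
    obtain ⟨z, s, hz⟩ := hcirc.exists_affine_eq hma hmsum 0 (hm0 0) hw
    have hterm : ∀ j, c j * ∏ i, Complex.exp (z i) ^ a j i = Complex.exp (-s) * m j := fun j => by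
      have hsum : ∑ i, (a j i : ℂ) * z i = w j + -s := by rw [hz j]; ring
      simp only [← Complex.exp_int_mul, ← Complex.exp_sum]
      rw [hsum, Complex.exp_add, hwu j]
      field_simp [hc j]
    have hζ : ∀ i, Complex.exp (z i) ≠ 0 := fun i => Complex.exp_ne_zero _
    refine ⟨fun i => Complex.exp (z i), hζ, ?_, fun i => ?_⟩
    · simp only [hterm, ← mul_sum]
      rw [← Int.cast_sum, hmsum, Int.cast_zero, mul_zero]
    · rw [hasDerivAt_laurent_update_zero_iff a c hζ i]
      simp only [hterm, mul_assoc, ← mul_sum]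
      have := congrFun hma i
      simp only [Finset.sum_apply, Pi.smul_apply, smul_eq_mul, Pi.zero_apply] at this
      rw [mul_eq_zero]
      right
      exact_mod_cast this
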